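/- Let Λ be a (C,C')-controlled g-frame for H with controlled g-frame operator S (bounded, positive, bijective with bounded inverse), and let S^{-1/2} denote the unique positive square root of S⁻¹. Assume S^{-1/2} commutes with C and with C'. Let J ⊆ ι and suppose S_J and S_{J^c} are bounded operators on H such that for every f ∈ H the families (P_i f)_{i∈J} and (P_i f)_{i∈J^c} are summable in H with sums S_J f and S_{J^c} f respectively. Then for every f ∈ H: Σ_{i∈J} ‖P_i^{1/2} f‖² + ‖S^{-1/2} S_{J^c} f‖² = Σ_{i∈J^c} ‖P_i^{1/2} f‖² + ‖S^{-1/2} S_J f‖². -/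

import Mathlib

open ContinuousLinearMap in
/-- If `T` is self-adjoint, then `‖T f‖² = re ⟪T (T f), f⟫`. -/
theorem IsSelfAdjoint.norm_apply_sq_eq_re_inner {H : Type*} [NormedAddCommGroup H]
    [InnerProductSpace ℂ H] [CompleteSpace H] {T : H →L[ℂ] H} (hT : IsSelfAdjoint T) (f : H) :
    ‖T f‖ ^ 2 = (inner ℂ (T (T f)) f : ℂ).re := by
  have h : inner ℂ (T (T f)) f = inner ℂ (T f) (T f) := by
    rw [← adjoint_inner_right, hT.adjoint_eq]
  rw [h]
  exact norm_sq_eq_re_inner (𝕜 := ℂ) (T f)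

/-- If the operators `Q i ∘ Q i`, with `Q i` self-adjoint, sum to `s` at `f`, then the numbers
`‖Q i f‖²` sum to `re ⟪s, f⟫`. -/
theorem hasSum_norm_sq_of_hasSum_apply_apply {H κ : Type*} [NormedAddCommGroup H]
    [InnerProductSpace ℂ H] [CompleteSpace H] {Q : κ → H →L[ℂ] H}
    (hQ : ∀ i, IsSelfAdjoint (Q i)) {f s : H} (hs : HasSum (fun i => Q i (Q i f)) s) :
    HasSum (fun i => ‖Q i f‖ ^ 2) (inner ℂ s f : ℂ).re := by
  have h := (hs.mapL (innerSL ℂ f)).mapL Complex.reCLM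
  have hre (x : H) : (inner ℂ f x : ℂ).re = (inner ℂ x f : ℂ).re := inner_re_symm (𝕜 := ℂ) f x
  simpa [(hQ _).norm_apply_sq_eq_re_inner, hre] using h

/-- For a `(C,C')`-controlled g-frame whose frame operator `S` has positive
square root `S^{-1/2}` of `S⁻¹` commuting with `C` and `C'`, and partial sum operators
`S_J`, `S_{J^c}` of the `P_i`: for every `f`,
`Σ_{i∈J} ‖P_i^{1/2}f‖² + ‖S^{-1/2} S_{J^c} f‖² = Σ_{i∈J^c} ‖P_i^{1/2}f‖² + ‖S^{-1/2} S_J f‖²`. -/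
theorem stmt_16 {H : Type*} [NormedAddCommGroup H] [InnerProductSpace ℂ H] [CompleteSpace H]
    {ι : Type*} {G : ι → Type*} [∀ i, NormedAddCommGroup (G i)]
    [∀ i, InnerProductSpace ℂ (G i)] [∀ i, CompleteSpace (G i)]
    (Λ : ∀ i, H →L[ℂ] G i) (C C' : H →L[ℂ] H)
    (hC : ∃ Ci : H →L[ℂ] H, Ci.comp C = 1 ∧ C.comp Ci = 1)
    (hC' : ∃ Ci : H →L[ℂ] H, Ci.comp C' = 1 ∧ C'.comp Ci = 1)
    (P : ι → H →L[ℂ] H)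
    (hP : ∀ i, P i = (ContinuousLinearMap.adjoint C).comp
      ((ContinuousLinearMap.adjoint (Λ i)).comp ((Λ i).comp C')))
    (hPsa : ∀ i, IsSelfAdjoint (P i))
    (hPpos : ∀ i, ∀ f : H, 0 ≤ (inner ℂ (P i f) f : ℂ).re)
    (Psqrt : ι → H →L[ℂ] H)
    (hPsqsa : ∀ i, IsSelfAdjoint (Psqrt i))
    (hPsqpos : ∀ i, ∀ f : H, 0 ≤ (inner ℂ (Psqrt i f) f : ℂ).re)
    (hPsq : ∀ i, (Psqrt i).comp (Psqrt i) = P i)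
    (A B : ℝ) (hA : 0 < A) (hAB : A ≤ B)
    (hframe : ∀ f : H, Summable (fun i => ‖Psqrt i f‖ ^ 2) ∧
      A * ‖f‖ ^ 2 ≤ ∑' i, ‖Psqrt i f‖ ^ 2 ∧ (∑' i, ‖Psqrt i f‖ ^ 2) ≤ B * ‖f‖ ^ 2)
    (S : H →L[ℂ] H) (hS : ∀ f : H, HasSum (fun i => P i f) (S f))
    (hSsa : IsSelfAdjoint S) (hSpos : ∀ f : H, 0 ≤ (inner ℂ (S f) f : ℂ).re)
    (Sinv : H →L[ℂ] H) (hSinv : Sinv.comp S = 1 ∧ S.comp Sinv = 1)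
    (R : H →L[ℂ] H) (hRsa : IsSelfAdjoint R)
    (hRpos : ∀ f : H, 0 ≤ (inner ℂ (R f) f : ℂ).re)
    (hRsq : R.comp R = Sinv)
    (hRC : R.comp C = C.comp R) (hRC' : R.comp C' = C'.comp R)
    (J : Set ι) (SJ SJc : H →L[ℂ] H)
    (hSJ : ∀ f : H, HasSum (fun i : J => P (i : ι) f) (SJ f))
    (hSJc : ∀ f : H, HasSum (fun i : ↥Jᶜ => P (i : ι) f) (SJc f)) :
    ∀ f : H, (∑' i : J, ‖Psqrt (i : ι) f‖ ^ 2) + ‖R (SJc f)‖ ^ 2 =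
      (∑' i : ↥Jᶜ, ‖Psqrt (i : ι) f‖ ^ 2) + ‖R (SJ f)‖ ^ 2 := by
  intro f
  have hPf (i : ι) : Psqrt i (Psqrt i f) = P i f := DFunLike.congr_fun (hPsq i) f
  have hJ : ∑' i : J, ‖Psqrt (i : ι) f‖ ^ 2 = (inner ℂ (SJ f) f : ℂ).re :=
    (hasSum_norm_sq_of_hasSum_apply_apply (fun i : J => hPsqsa i)
      (by simpa only [hPf] using hSJ f)).tsum_eq
  have hJc : ∑' i : ↥Jᶜ, ‖Psqrt (i : ι) f‖ ^ 2 = (inner ℂ (SJc f) f : ℂ).re :=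
    (hasSum_norm_sq_of_hasSum_apply_apply (fun i : ↥Jᶜ => hPsqsa i)
      (by simpa only [hPf] using hSJc f)).tsum_eq
  have hadd : SJ f + SJc f = S f :=
    (HasSum.add_compl (f := fun i => P i f) (s := J) (hSJ f) (hSJc f)).unique (hS f)
  have hRR (x : H) : R (R x) = Sinv x := DFunLike.congr_fun hRsq x
  have hf : Sinv (SJ f) + Sinv (SJc f) = f := by
    rw [← map_add, hadd]
    exact DFunLike.congr_fun hSinv.1 f
  have hsymm : (inner ℂ (Sinv (SJ f)) (SJc f) : ℂ).re =
      (inner ℂ (Sinv (SJc f)) (SJ f) : ℂ).re := by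
    rw [← hRR, ← hRR, ← ContinuousLinearMap.adjoint_inner_right,
      ← ContinuousLinearMap.adjoint_inner_right, hRsa.adjoint_eq]
    exact inner_re_symm (𝕜 := ℂ) _ _
  have hinner (x : H) : (inner ℂ x f : ℂ).re =
      (inner ℂ (Sinv (SJ f)) x : ℂ).re + (inner ℂ (Sinv (SJc f)) x : ℂ).re := by
    rw [← Complex.add_re, ← inner_add_left, hf]
    exact inner_re_symm (𝕜 := ℂ) _ _
  rw [hJ, hJc, hRsa.norm_apply_sq_eq_re_inner, hRsa.norm_apply_sq_eq_re_inner, hRR, hRR,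
    hinner, hinner]
  linarith
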